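/- Let G be a locally finite connected simple graph with vertex labeling l : V(G) → ℝ≥0 and let d_l be the distance generated by G(l). Then d_l is an ultrametric on V(G) if and only if max{l(u), l(v)} > 0 holds for every edge {u,v} ∈ E(G). -/

import Mathlib

open Classical in
/-- The distance `d_l` generated by a labeled graph `G(l)`:
`d_l x x = 0` and, for `x ≠ y`,
`d_l x y = inf over paths P joining x and y of (max_{v ∈ V(P)} l v)`. -/
noncomputable def labelDist {V : Type*} (G : SimpleGraph V) (l : V → NNReal)
    (x y : V) : NNReal :=
  if x = y then 0
  else ⨅ p : {p : G.Walk x y // p.IsPath}, (p.1.support.map l).foldr max 0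

theorem foldr_max_zero_le_iff {L : List NNReal} {c : NNReal} :
    L.foldr max 0 ≤ c ↔ ∀ a ∈ L, a ≤ c := by
  induction L with
  | nil => simp
  | cons a L ih => simp [ih]

theorem labelDist_self {V : Type*} (G : SimpleGraph V) (l : V → NNReal) (x : V) :
    labelDist G l x x = 0 := by
  simp [labelDist]

theorem labelDist_le_of_walk {V : Type*} {G : SimpleGraph V} {l : V → NNReal} {x y : V}
    {c : NNReal} (w : G.Walk x y) (h : ∀ v ∈ w.support, l v ≤ c) :
    labelDist G l x y ≤ c := by
  classical
  by_cases hxy : x = y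
  · simp [labelDist, hxy]
  · rw [labelDist, if_neg hxy]
    refine (ciInf_le (OrderBot.bddBelow _) ⟨w.bypass, w.bypass_isPath⟩).trans ?_
    rw [foldr_max_zero_le_iff]
    intro a ha
    obtain ⟨v, hv, rfl⟩ := List.mem_map.1 ha
    exact h v (w.support_bypass_subset_support hv)

theorem exists_walk_of_labelDist_lt {V : Type*} {G : SimpleGraph V} (hc : G.Connected)
    {l : V → NNReal} {x y : V} {c : NNReal} (hxy : x ≠ y) (h : labelDist G l x y < c) :
    ∃ w : G.Walk x y, ∀ v ∈ w.support, l v < c := by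
  rw [labelDist, if_neg hxy] at h
  obtain ⟨p, hp⟩ := hc.preconnected.exists_isPath x y
  have : Nonempty {p : G.Walk x y // p.IsPath} := ⟨⟨p, hp⟩⟩
  obtain ⟨q, hq⟩ := exists_lt_of_ciInf_lt h
  exact ⟨q.1, fun v hv =>
    (foldr_max_zero_le_iff.1 le_rfl _ (List.mem_map_of_mem hv)).trans_lt hq⟩

theorem labelDist_comm_le {V : Type*} {G : SimpleGraph V} (hc : G.Connected)
    (l : V → NNReal) (x y : V) : labelDist G l x y ≤ labelDist G l y x := by
  by_cases hxy : x = y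
  · rw [hxy]
  · refine le_of_forall_gt_imp_ge_of_dense fun c h => ?_
    obtain ⟨w, hw⟩ := exists_walk_of_labelDist_lt hc (Ne.symm hxy) h
    exact labelDist_le_of_walk w.reverse fun v hv => (hw v (by simpa using hv)).le

theorem labelDist_le_max {V : Type*} {G : SimpleGraph V} (hc : G.Connected)
    (l : V → NNReal) (x y z : V) :
    labelDist G l x y ≤ max (labelDist G l x z) (labelDist G l z y) := by
  by_cases hxz : x = z
  · simp [hxz]
  by_cases hzy : z = y
  · simp [hzy]
  refine le_of_forall_gt_imp_ge_of_dense fun c h => ?_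
  obtain ⟨h₁, h₂⟩ := max_lt_iff.1 h
  obtain ⟨p, hp⟩ := exists_walk_of_labelDist_lt hc hxz h₁
  obtain ⟨q, hq⟩ := exists_walk_of_labelDist_lt hc hzy h₂
  refine labelDist_le_of_walk (p.append q) fun v hv => ?_
  rcases (SimpleGraph.Walk.mem_support_append_iff p q).1 hv with hv | hv
  · exact (hp v hv).le
  · exact (hq v hv).le

theorem labelDist_pos {V : Type*} {G : SimpleGraph V} (hc : G.Connected) {l : V → NNReal}
    {x y : V} (hfin : (G.neighborSet x).Finite)
    (h : ∀ v, G.Adj x v → 0 < max (l x) (l v)) (hxy : x ≠ y) :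
    0 < labelDist G l x y := by
  have hne : (G.neighborSet x).Nonempty := by
    obtain ⟨p⟩ := hc.preconnected x y
    cases p with
    | nil => exact absurd rfl hxy
    | cons hadj _ => exact ⟨_, hadj⟩
  obtain ⟨u, hu, hmin⟩ := Set.exists_min_image _ (fun v => max (l x) (l v)) hfin hne
  refine (h u hu).trans_le (le_of_not_gt fun hlt => ?_)
  obtain ⟨w, hw⟩ := exists_walk_of_labelDist_lt hc hxy hlt
  cases w with
  | nil => exact hxy rfl
  | cons hadj p =>
    exact (hmin _ hadj).not_gt (max_lt (hw _ (by simp)) (hw _ (by simp)))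

/-- For a locally finite connected labeled graph `G(l)`, the
distance `d_l` is an ultrametric on `V(G)` iff `max {l u, l v} > 0` for every
edge `{u,v} ∈ E(G)`. -/
theorem labelDist_ultrametric_iff_of_locallyFinite {V : Type*}
    (G : SimpleGraph V) (hc : G.Connected)
    (hlf : ∀ v : V, (G.neighborSet v).Finite) (l : V → NNReal) :
    ((∀ x y, labelDist G l x y = labelDist G l y x) ∧
     (∀ x y, labelDist G l x y = 0 ↔ x = y) ∧
     (∀ x y z, labelDist G l x y ≤ max (labelDist G l x z) (labelDist G l z y)))
      ↔ ∀ u v : V, G.Adj u v → 0 < max (l u) (l v) := by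
  constructor
  · rintro ⟨-, h, -⟩ u v huv
    by_contra hnot
    have h₀ : max (l u) (l v) ≤ 0 := not_lt.1 hnot
    refine huv.ne ((h u v).1 (le_antisymm (labelDist_le_of_walk huv.toWalk fun a ha => ?_) zero_le))
    have ha' : a = u ∨ a = v := by simpa using ha
    rcases ha' with rfl | rfl
    · exact (le_max_left _ _).trans h₀
    · exact (le_max_right _ _).trans h₀
  · intro h
    refine ⟨fun x y => le_antisymm (labelDist_comm_le hc l x y) (labelDist_comm_le hc l y x),
      fun x y => ⟨fun h₀ => ?_, fun hxy => hxy ▸ labelDist_self G l x⟩, labelDist_le_max hc l⟩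
    by_contra hxy
    exact (labelDist_pos hc (hlf x) (h x) hxy).ne' h₀
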